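/- For every q ∈ [1,2], δ > 0, σ_w > 0, and any random variable B with E[B²] < ∞ independent of Z ~ N(0,1), the equation σ² = σ_w² + (1/δ)·min_{χ ≥ 0} E[(η_q(B + σZ; χ) − B)²] has a unique solution σ ∈ (0,∞). -/

import Mathlib

open MeasureTheory ProbabilityTheory Real Filter Set

noncomputable section

/-- The standard Gaussian measure on `ℝ`. -/
def stdGaussian : Measure ℝ := gaussianReal 0 1

/-- `IsProx q χ u v` : `v` minimizes `z ↦ (1/2)(u−z)² + χ|z|^q`,
i.e. `v = η_q(u;χ)` is the proximal operator of `χ|·|^q` at `u`. -/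
def IsProx (q χ u v : ℝ) : Prop :=
  ∀ z : ℝ, (1/2) * (u - v)^2 + χ * |v| ^ q ≤ (1/2) * (u - z)^2 + χ * |z| ^ q

theorem IsProx.inner_le {q χ u v : ℝ} (hq : 1 ≤ q) (hχ : 0 ≤ χ) (h : IsProx q χ u v) (z : ℝ) :
    (u - v) * (z - v) ≤ χ * (|z| ^ q - |v| ^ q) := by
  have key : ∀ t : ℝ, 0 < t → t ≤ 1 →
      (u - v) * (z - v) - χ * (|z| ^ q - |v| ^ q) ≤ t * ((z - v) ^ 2 / 2) := by
    intro t ht ht1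
    have h1 := h ((1 - t) * v + t * z)
    have h2 : |(1 - t) * v + t * z| ≤ (1 - t) * |v| + t * |z| := by
      refine (abs_add_le _ _).trans (le_of_eq ?_)
      rw [abs_mul, abs_mul, abs_of_nonneg (sub_nonneg.2 ht1), abs_of_pos ht]
    have h3 : |(1 - t) * v + t * z| ^ q ≤ (1 - t) * |v| ^ q + t * |z| ^ q := by
      refine (Real.rpow_le_rpow (abs_nonneg _) h2 (by linarith)).trans ?_
      have := (convexOn_rpow hq).2 (abs_nonneg v : |v| ∈ Ici (0:ℝ))
        (abs_nonneg z : |z| ∈ Ici (0:ℝ)) (sub_nonneg.2 ht1) ht.le (by ring)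
      simpa [smul_eq_mul] using this
    have h4 := mul_le_mul_of_nonneg_left h3 hχ
    have h5 : t * ((u - v) * (z - v) - χ * (|z| ^ q - |v| ^ q)) ≤ t * (t * ((z - v) ^ 2 / 2)) := by
      nlinarith
    exact le_of_mul_le_mul_left h5 ht
  have hlim : Tendsto (fun t : ℝ => t * ((z - v) ^ 2 / 2)) (nhdsWithin 0 (Ioi 0)) (nhds 0) := by
    have : Tendsto (fun t : ℝ => t * ((z - v) ^ 2 / 2)) (nhds 0) (nhds (0 * ((z - v) ^ 2 / 2))) :=
      (continuous_id.mul continuous_const).tendsto 0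
    rw [zero_mul] at this
    exact this.mono_left nhdsWithin_le_nhds
  have := ge_of_tendsto hlim (b := (u - v) * (z - v) - χ * (|z| ^ q - |v| ^ q)) (by
    filter_upwards [Ioc_mem_nhdsGT (zero_lt_one' ℝ)] with t ht using key t ht.1 ht.2)
  linarith

theorem IsProx.firmly_nonexpansive {q χ u₁ v₁ u₂ v₂ : ℝ} (hq : 1 ≤ q) (hχ : 0 ≤ χ)
    (h₁ : IsProx q χ u₁ v₁) (h₂ : IsProx q χ u₂ v₂) :
    (v₁ - v₂) ^ 2 ≤ (u₁ - u₂) * (v₁ - v₂) := by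
  have a := h₁.inner_le hq hχ v₂
  have b := h₂.inner_le hq hχ v₁
  nlinarith

theorem IsProx.unique {q χ u v w : ℝ} (hq : 1 ≤ q) (hχ : 0 ≤ χ)
    (h₁ : IsProx q χ u v) (h₂ : IsProx q χ u w) : v = w := by
  have := h₁.firmly_nonexpansive hq hχ h₂
  nlinarith [sq_nonneg (v - w)]

theorem isProx_zero {q χ : ℝ} (hq : 1 ≤ q) (hχ : 0 ≤ χ) : IsProx q χ 0 0 := by
  intro z
  have : (0:ℝ) ^ q = 0 := Real.zero_rpow (by linarith)
  simp only [abs_zero, this]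
  have := mul_nonneg hχ (Real.rpow_nonneg (abs_nonneg z) q)
  nlinarith [sq_nonneg z]

theorem IsProx.neg {q χ u v : ℝ} (h : IsProx q χ u v) : IsProx q χ (-u) (-v) := by
  intro z
  have := h (-z)
  rw [abs_neg] at this ⊢
  nlinarith

theorem IsProx.smul {q χ u v c : ℝ} (hc : 0 < c) (h : IsProx q χ u v) :
    IsProx q (c ^ (2 - q) * χ) (c * u) (c * v) := by
  intro z
  have key : ∀ y : ℝ, 1 / 2 * (c * u - c * y) ^ 2 + c ^ (2 - q) * χ * |c * y| ^ q
      = c ^ 2 * (1 / 2 * (u - y) ^ 2 + χ * |y| ^ q) := by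
    intro y
    rw [abs_mul, abs_of_pos hc, Real.mul_rpow hc.le (abs_nonneg y)]
    have : c ^ (2 - q) * c ^ q = c ^ 2 := by
      rw [← Real.rpow_add hc, sub_add_cancel, Real.rpow_two]
    linear_combination (χ * |y| ^ q) * this
  have hz : z = c * (z / c) := by field_simp
  rw [hz, key, key]
  exact mul_le_mul_of_nonneg_left (h _) (sq_nonneg c)

theorem IsProx.nonneg {q χ u v : ℝ} (hq : 1 ≤ q) (hχ : 0 ≤ χ) (hu : 0 ≤ u)
    (h : IsProx q χ u v) : 0 ≤ v := by
  have := h.firmly_nonexpansive hq hχ (isProx_zero hq hχ)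
  by_contra! hv
  nlinarith

theorem IsProx.sub_le_deriv {q χ u v : ℝ} (hq : 1 ≤ q) (hχ : 0 ≤ χ) (hv : 0 ≤ v)
    (h : IsProx q χ u v) : u - v ≤ χ * (q * v ^ (q - 1)) := by
  have hd := ((Real.hasDerivAt_rpow_const (x := v) (Or.inr hq)).const_mul χ).hasDerivWithinAt
    (s := Ioi v)
  rw [hasDerivWithinAt_iff_tendsto_slope' (by simp)] at hd
  refine ge_of_tendsto hd ?_
  filter_upwards [self_mem_nhdsWithin] with z hz
  have hz' : v < z := hz
  have := h.inner_le hq hχ z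
  rw [abs_of_nonneg hv, abs_of_nonneg (hv.trans hz'.le)] at this
  rw [slope_def_field, le_div_iff₀ (sub_pos.2 hz')]
  linarith

theorem IsProx.deriv_le_sub {q χ u v : ℝ} (hq : 1 ≤ q) (hχ : 0 ≤ χ) (hv : 0 < v)
    (h : IsProx q χ u v) : χ * (q * v ^ (q - 1)) ≤ u - v := by
  have hd := ((Real.hasDerivAt_rpow_const (x := v) (Or.inr hq)).const_mul χ).hasDerivWithinAt
    (s := Iio v)
  rw [hasDerivWithinAt_iff_tendsto_slope' (by simp)] at hd
  refine le_of_tendsto hd ?_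
  filter_upwards [Ioo_mem_nhdsLT hv] with z hz
  have := h.inner_le hq hχ z
  rw [abs_of_nonneg hv.le, abs_of_nonneg hz.1.le] at this
  rw [slope_def_field, div_le_iff_of_neg (sub_neg.2 hz.2)]
  linarith

theorem abs_prox_sub_le {q χ : ℝ} {f : ℝ → ℝ} (hq : 1 ≤ q) (hχ : 0 ≤ χ)
    (hf : ∀ u, IsProx q χ u (f u)) (x y : ℝ) : |f x - f y| ≤ |x - y| := by
  have h := (hf x).firmly_nonexpansive hq hχ (hf y)
  rcases eq_or_ne (f x) (f y) with he | he
  · simp [he]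
  have h1 : 0 < |f x - f y| := abs_pos.2 (sub_ne_zero.2 he)
  have h2 : |f x - f y| * |f x - f y| ≤ |x - y| * |f x - f y| := by
    rw [← abs_mul, ← abs_mul, abs_mul_self, ← pow_two]
    exact h.trans (le_abs_self _)
  exact le_of_mul_le_mul_right h2 h1

theorem continuous_prox {q χ : ℝ} {f : ℝ → ℝ} (hq : 1 ≤ q) (hχ : 0 ≤ χ)
    (hf : ∀ u, IsProx q χ u (f u)) : Continuous f := by
  refine (LipschitzWith.of_dist_le_mul (K := 1) fun x y => ?_).continuous
  simpa [Real.dist_eq] using abs_prox_sub_le hq hχ hf x y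

theorem prox_zero {q χ : ℝ} {f : ℝ → ℝ} (hq : 1 ≤ q) (hχ : 0 ≤ χ)
    (hf : ∀ u, IsProx q χ u (f u)) : f 0 = 0 :=
  (hf 0).unique hq hχ (isProx_zero hq hχ)

theorem abs_prox_le {q χ : ℝ} {f : ℝ → ℝ} (hq : 1 ≤ q) (hχ : 0 ≤ χ)
    (hf : ∀ u, IsProx q χ u (f u)) (x : ℝ) : |f x| ≤ |x| := by
  simpa [prox_zero hq hχ hf] using abs_prox_sub_le hq hχ hf x 0

theorem prox_neg {q χ : ℝ} {f : ℝ → ℝ} (hq : 1 ≤ q) (hχ : 0 ≤ χ)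
    (hf : ∀ u, IsProx q χ u (f u)) (x : ℝ) : f (-x) = -f x :=
  (hf (-x)).unique hq hχ (hf x).neg

theorem monotone_sub_prox {q χ : ℝ} {f : ℝ → ℝ} (hq : 1 ≤ q) (hχ : 0 ≤ χ)
    (hf : ∀ u, IsProx q χ u (f u)) : Monotone fun u => u - f u := by
  intro x y hxy
  have := abs_prox_sub_le hq hχ hf y x
  rw [abs_of_nonneg (sub_nonneg.2 hxy)] at this
  have := (le_abs_self _).trans this
  simp only
  linarith

theorem concaveOn_sub_prox {q χ : ℝ} {f : ℝ → ℝ} (hq : 1 ≤ q) (hq2 : q ≤ 2) (hχ : 0 ≤ χ)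
    (hf : ∀ u, IsProx q χ u (f u)) : ConcaveOn ℝ (Ici 0) fun u => u - f u := by
  refine ⟨convex_Ici 0, fun x hx y hy a b ha hb hab => ?_⟩
  simp only [smul_eq_mul]
  have hx0 := (hf x).nonneg hq hχ hx
  have hy0 := (hf y).nonneg hq hχ hy
  by_contra! hlt
  set w := a * f x + b * f y with hw
  have hw0 : 0 ≤ w := by positivity
  have hwv : w < f (a * x + b * y) := by linarith
  have h1 := (hf (a * x + b * y)).deriv_le_sub hq hχ (hw0.trans_lt hwv)
  have h2 : w ^ (q - 1) ≤ f (a * x + b * y) ^ (q - 1) :=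
    Real.rpow_le_rpow hw0 hwv.le (by linarith)
  have h3 : a * f x ^ (q - 1) + b * f y ^ (q - 1) ≤ w ^ (q - 1) := by
    simpa [smul_eq_mul] using
      (Real.concaveOn_rpow (p := q - 1) (by linarith) (by linarith)).2 hx0 hy0 ha hb hab
  have h4 := mul_le_mul_of_nonneg_left ((hf x).sub_le_deriv hq hχ hx0) ha
  have h5 := mul_le_mul_of_nonneg_left ((hf y).sub_le_deriv hq hχ hy0) hb
  have h6 := mul_le_mul_of_nonneg_left (h3.trans h2) (mul_nonneg hχ (zero_le_one.trans hq))
  nlinarith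

theorem tendsto_prox_atTop {q u : ℝ} (hq : 1 ≤ q) {v : ℕ → ℝ}
    (hv : ∀ n : ℕ, IsProx q n u (v n)) : Tendsto v atTop (nhds 0) := by
  have hq0 : 0 < q := by linarith
  have h1 : ∀ n : ℕ, 0 < n → |v n| ^ q ≤ u ^ 2 / 2 / n := by
    intro n hn
    have := hv n 0
    rw [abs_zero, Real.zero_rpow hq0.ne'] at this
    rw [le_div_iff₀ (by exact_mod_cast hn)]
    nlinarith [sq_nonneg (u - v n)]
  have h2 : Tendsto (fun n => |v n| ^ q) atTop (nhds 0) := by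
    refine squeeze_zero' (.of_forall fun n => by positivity) ?_
      (tendsto_const_div_atTop_nhds_zero_nat (u ^ 2 / 2))
    filter_upwards [eventually_gt_atTop 0] with n hn using h1 n hn
  have h3 := h2.rpow_const (p := q⁻¹) (Or.inr (by positivity))
  rw [Real.zero_rpow (inv_ne_zero hq0.ne')] at h3
  rw [tendsto_zero_iff_abs_tendsto_zero]
  refine h3.congr fun n => ?_
  rw [← Real.rpow_mul (abs_nonneg _), mul_inv_cancel₀ hq0.ne', Real.rpow_one]
  rfl

theorem ConcaveOn.add_le_add_of_add_eq {s : Set ℝ} {h : ℝ → ℝ} (hc : ConcaveOn ℝ s h)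
    {a b c d : ℝ} (ha : a ∈ s) (hd : d ∈ s) (hab : a ≤ b) (hac : a ≤ c) (hsum : a + d = b + c) :
    h a + h d ≤ h b + h c := by
  rcases hab.eq_or_lt with rfl | hab'
  · have : d = c := by linarith
    rw [this]
  have had : 0 < d - a := by linarith
  set t := (b - a) / (d - a) with ht
  have ht0 : 0 ≤ t := div_nonneg (by linarith) had.le
  have ht1 : 0 ≤ 1 - t := by
    rw [sub_nonneg, ht, div_le_one had]; linarith
  have htm : t * (d - a) = b - a := by rw [ht]; field_simp
  have h1 := hc.2 ha hd ht1 ht0 (by ring)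
  have h2 := hc.2 ha hd ht0 ht1 (by ring)
  simp only [smul_eq_mul] at h1 h2
  rw [show (1 - t) * a + t * d = b by linarith] at h1
  rw [show t * a + (1 - t) * d = c by linarith] at h2
  linarith

theorem add_shift_antitone_of_odd_of_concaveOn {h : ℝ → ℝ} (hodd : ∀ x, h (-x) = -h x)
    (hc : ConcaveOn ℝ (Ici 0) h) {z s t : ℝ} (hz : 0 ≤ z) (hs : 0 ≤ s) (hst : s ≤ t) :
    h (z + t) + h (z - t) ≤ h (z + s) + h (z - s) := by
  have inner : ∀ s t : ℝ, 0 ≤ s → s ≤ t → t ≤ z →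
      h (z + t) + h (z - t) ≤ h (z + s) + h (z - s) := by
    intro s t hs hst htz
    have := hc.add_le_add_of_add_eq (a := z - t) (d := z + t) (b := z - s) (c := z + s)
      (by simpa using htz) (by simp only [mem_Ici]; linarith) (by linarith) (by linarith) (by ring)
    linarith
  have outer : ∀ s t : ℝ, z ≤ s → s ≤ t →
      h (z + t) + h (z - t) ≤ h (z + s) + h (z - s) := by
    intro s t hzs hst
    have := hc.add_le_add_of_add_eq (a := s - z) (d := z + t) (b := z + s) (c := t - z)
      (by simpa using hzs) (by simp only [mem_Ici]; linarith) (by linarith) (by linarith) (by ring)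
    have e1 := hodd (s - z)
    have e2 := hodd (t - z)
    rw [neg_sub] at e1 e2
    linarith
  rcases le_total t z with h1 | h1
  · exact inner s t hs hst h1
  rcases le_total z s with h2 | h2
  · exact outer s t h2 hst
  · exact (outer z t le_rfl h1).trans (inner s z hs h2 le_rfl)

instance : IsProbabilityMeasure stdGaussian := by
  unfold _root_.stdGaussian; infer_instance

theorem integral_stdGaussian_comp_neg (g : ℝ → ℝ) :
    ∫ z, g (-z) ∂stdGaussian = ∫ z, g z ∂stdGaussian := by
  have h : Measure.map (fun z : ℝ => -z) _root_.stdGaussian = _root_.stdGaussian := by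
    simp [_root_.stdGaussian, gaussianReal_map_neg]
  exact (MeasurePreserving.mk measurable_neg h).integral_comp
    (MeasurableEquiv.neg ℝ).measurableEmbedding g

theorem integral_stdGaussian_eq (g : ℝ → ℝ) :
    ∫ z, g z ∂stdGaussian = ∫ z, gaussianPDFReal 0 1 z * g z := by
  simp [_root_.stdGaussian, integral_gaussianReal_eq_integral_smul]

theorem integrable_stdGaussian_iff (g : ℝ → ℝ) :
    Integrable g stdGaussian ↔ Integrable (fun z => gaussianPDFReal 0 1 z * g z) := by
  rw [_root_.stdGaussian, gaussianReal_of_var_ne_zero _ one_ne_zero,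
    integrable_withDensity_iff_integrable_smul' (measurable_gaussianPDF 0 1)
      (.of_forall fun x => by simp [gaussianPDF])]
  simp [toReal_gaussianPDF]

theorem integrable_sq_stdGaussian : Integrable (fun z : ℝ => z ^ 2) stdGaussian := by
  have := (memLp_id_gaussianReal (μ := 0) (v := 1) 2).integrable_sq
  simpa [_root_.stdGaussian] using this

theorem integrable_stdGaussian_of_abs_le {f : ℝ → ℝ} (hf : Continuous f) {C D : ℝ}
    (hb : ∀ z, |f z| ≤ C + D * z ^ 2) : Integrable f stdGaussian := by
  refine ((integrable_const C).add (integrable_sq_stdGaussian.const_mul D)).mono'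
    hf.aestronglyMeasurable (.of_forall fun z => ?_)
  simpa using hb z

theorem gaussianPDFReal_le_of_abs_le {x y : ℝ} (h : |x| ≤ |y|) :
    gaussianPDFReal 0 1 y ≤ gaussianPDFReal 0 1 x := by
  have := sq_le_sq.2 h
  simp only [gaussianPDFReal]
  refine mul_le_mul_of_nonneg_left (Real.exp_le_exp.2 ?_) (by positivity)
  simp only [sub_zero, NNReal.coe_one]
  linarith

theorem gaussianPDFReal_zero_one_neg (x : ℝ) :
    gaussianPDFReal 0 1 (-x) = gaussianPDFReal 0 1 x := by
  simp [gaussianPDFReal]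

theorem integral_stdGaussian_shift_mono {g : ℝ → ℝ} (hg : ∀ x y, |x| ≤ |y| → g x ≤ g y)
    {s t : ℝ} (hs : 0 ≤ s) (hst : s ≤ t)
    (hint : ∀ r, Integrable (fun z => g (r + z)) stdGaussian) :
    ∫ z, g (s + z) ∂stdGaussian ≤ ∫ z, g (t + z) ∂stdGaussian := by
  obtain ⟨m, a, hm, ha, rfl, rfl⟩ : ∃ m a : ℝ, 0 ≤ m ∧ 0 ≤ a ∧ s = m - a ∧ t = m + a :=
    ⟨(s + t) / 2, (t - s) / 2, by linarith, by linarith, by ring, by ring⟩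
  set φ := gaussianPDFReal 0 1 with hφ
  -- integrals against a shifted Gaussian density, in the coordinate centred at `m`
  have shift : ∀ c : ℝ, Integrable (fun w => φ (w - c) * g (m + w)) ∧
      ∫ w, φ (w - c) * g (m + w) = ∫ z, g (m + c + z) ∂stdGaussian := by
    intro c
    have e : (fun w => φ (w - c) * g (m + w)) =
        fun w => (fun z => φ z * g (m + c + z)) (w - c) := by
      funext w
      simp only
      rw [show m + c + (w - c) = m + w by ring]
    constructor
    · rw [e]
      exact ((integrable_stdGaussian_iff _).1 (hint (m + c))).comp_sub_right c
    · rw [e, integral_sub_right_eq_self (fun z => φ z * g (m + c + z)) c,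
        integral_stdGaussian_eq]
  have flip : ∀ c : ℝ, Integrable (fun w => φ (w + c) * g (m - w)) ∧
      ∫ w, φ (w + c) * g (m - w) = ∫ z, g (m + c + z) ∂stdGaussian := by
    intro c
    have e : (fun w => φ (w + c) * g (m - w)) =
        fun w => (fun w => φ (w - c) * g (m + w)) (-w) := by
      funext w
      simp only
      rw [show -w - c = -(w + c) by ring, hφ, gaussianPDFReal_zero_one_neg, ← sub_eq_add_neg]
    constructor
    · rw [e]; exact (shift c).1.comp_neg
    · rw [e, integral_neg_eq_self (fun w => φ (w - c) * g (m + w)), (shift c).2]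
  obtain ⟨i1, e1⟩ := shift a
  obtain ⟨i2, e2⟩ := shift (-a)
  obtain ⟨i3, e3⟩ := flip a
  obtain ⟨i4, e4⟩ := flip (-a)
  have hle : ∫ w, (φ (w - -a) * g (m + w) + φ (w + -a) * g (m - w)) ≤
      ∫ w, (φ (w - a) * g (m + w) + φ (w + a) * g (m - w)) := by
    refine integral_mono (i2.add i4) (i1.add i3) fun w => ?_
    simp only [sub_neg_eq_add, ← sub_eq_add_neg]
    have : 0 ≤ (φ (w - a) - φ (w + a)) * (g (m + w) - g (m - w)) := by
      rcases le_total 0 w with hw | hw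
      · refine mul_nonneg (sub_nonneg.2 (gaussianPDFReal_le_of_abs_le ?_))
          (sub_nonneg.2 (hg _ _ ?_)) <;> rw [← sq_le_sq] <;> nlinarith
      · refine mul_nonneg_of_nonpos_of_nonpos (sub_nonpos.2 (gaussianPDFReal_le_of_abs_le ?_))
          (sub_nonpos.2 (hg _ _ ?_)) <;> rw [← sq_le_sq] <;> nlinarith
    linarith
  rw [integral_add i2 i4, integral_add i1 i3, e1, e2, e3, e4, ← sub_eq_add_neg] at hle
  linarith

theorem integral_stdGaussian_mul_shift_anti {h : ℝ → ℝ} (hodd : ∀ x, h (-x) = -h x)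
    (hc : ConcaveOn ℝ (Ici 0) h) {s t : ℝ} (hs : 0 ≤ s) (hst : s ≤ t)
    (hint : ∀ r, Integrable (fun z => z * h (r + z)) stdGaussian) :
    ∫ z, z * h (t + z) ∂stdGaussian ≤ ∫ z, z * h (s + z) ∂stdGaussian := by
  have sym : ∀ r, ∫ z, z * h (r + z) ∂stdGaussian = ∫ z, z * h (-r + z) ∂stdGaussian := by
    intro r
    rw [← integral_stdGaussian_comp_neg]
    congr 1 with z
    rw [show r + -z = -(-r + z) by ring, hodd]
    ring
  have hle : ∫ z, (z * h (t + z) + z * h (-t + z)) ∂stdGaussian ≤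
      ∫ z, (z * h (s + z) + z * h (-s + z)) ∂stdGaussian := by
    refine integral_mono ((hint t).add (hint (-t))) ((hint s).add (hint (-s))) fun z => ?_
    simp only
    rcases le_total 0 z with hz | hz
    · have := add_shift_antitone_of_odd_of_concaveOn hodd hc hz hs hst
      rw [add_comm t, add_comm s, neg_add_eq_sub, neg_add_eq_sub]
      nlinarith
    · have := add_shift_antitone_of_odd_of_concaveOn hodd hc (neg_nonneg.2 hz) hs hst
      rw [show -z + t = -(-t + z) by ring, show -z - t = -(t + z) by ring,
        show -z + s = -(-s + z) by ring, show -z - s = -(s + z) by ring,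
        hodd, hodd, hodd, hodd] at this
      nlinarith
  rw [integral_add (hint t) (hint (-t)), integral_add (hint s) (hint (-s)), ← sym, ← sym] at hle
  linarith

/-- The quadratic risk of `u ↦ u - h u` at signal `s` in unit Gaussian noise is monotone in `|s|`. -/
theorem integral_residual_mono {h : ℝ → ℝ} (hcont : Continuous h) (hmono : Monotone h)
    (hodd : ∀ x, h (-x) = -h x) (hbd : ∀ x, |h x| ≤ |x|) (hc : ConcaveOn ℝ (Ici 0) h)
    {s t : ℝ} (hst : |s| ≤ |t|) :
    ∫ z, (z - h (s + z)) ^ 2 ∂stdGaussian ≤ ∫ z, (z - h (t + z)) ^ 2 ∂stdGaussian := by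
  have hsq : ∀ r z, h (r + z) ^ 2 ≤ 2 * r ^ 2 + 2 * z ^ 2 := fun r z => by
    nlinarith [sq_le_sq.2 (hbd (r + z)), sq_nonneg (r - z)]
  have i1 : ∀ r, Integrable (fun z => h (r + z) ^ 2) stdGaussian := fun r =>
    integrable_stdGaussian_of_abs_le (by fun_prop) (C := 2 * r ^ 2) (D := 2) fun z => by
      rw [abs_of_nonneg (sq_nonneg _)]; exact hsq r z
  have i2 : ∀ r, Integrable (fun z => z * h (r + z)) stdGaussian := fun r =>
    integrable_stdGaussian_of_abs_le (by fun_prop) (C := 2 * r ^ 2) (D := 3) fun z => by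
      have := hsq r z
      rw [abs_le]
      constructor <;> nlinarith [sq_nonneg (z - h (r + z)), sq_nonneg (z + h (r + z))]
  have expand : ∀ r, ∫ z, (z - h (r + z)) ^ 2 ∂stdGaussian =
      ∫ z, z ^ 2 ∂stdGaussian - 2 * ∫ z, z * h (r + z) ∂stdGaussian
        + ∫ z, h (r + z) ^ 2 ∂stdGaussian := by
    intro r
    rw [← integral_const_mul, ← integral_sub integrable_sq_stdGaussian ((i2 r).const_mul 2),
      ← integral_add (f := fun z => z ^ 2 - 2 * (z * h (r + z)))
        (integrable_sq_stdGaussian.sub ((i2 r).const_mul 2)) (i1 r)]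
    congr 1 with z
    ring
  have habs : ∀ r, ∫ z, (z - h (r + z)) ^ 2 ∂stdGaussian =
      ∫ z, (z - h (|r| + z)) ^ 2 ∂stdGaussian := by
    intro r
    rcases abs_choice r with hr | hr
    · rw [hr]
    · rw [hr, ← integral_stdGaussian_comp_neg]
      congr 1 with z
      rw [show r + -z = -(-r + z) by ring, hodd]
      ring
  have hg : ∀ x y, |x| ≤ |y| → h x ^ 2 ≤ h y ^ 2 := by
    have h0 : h 0 = 0 := by simpa using hbd 0
    have habs' : ∀ x, h x ^ 2 = h |x| ^ 2 := fun x => by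
      rcases abs_choice x with hx | hx <;> rw [hx]
      rw [hodd, neg_sq]
    intro x y hxy
    rw [habs' x, habs' y]
    have := hmono (abs_nonneg x)
    rw [h0] at this
    exact pow_le_pow_left₀ this (hmono hxy) 2
  rw [habs s, habs t, expand, expand]
  have a := integral_stdGaussian_shift_mono hg (abs_nonneg s) hst i1
  have b := integral_stdGaussian_mul_shift_anti hodd hc (abs_nonneg s) hst i2
  linarith

/-- The mean squared error of the estimator `f` of a signal with law `μ` observed in Gaussian noise
of standard deviation `σ`. -/
def quadRisk (μ : Measure ℝ) (f : ℝ → ℝ) (σ : ℝ) : ℝ :=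
  ∫ b, (∫ z, (f (b + σ * z) - b) ^ 2 ∂_root_.stdGaussian) ∂μ

theorem quadRisk_nonneg (μ : Measure ℝ) (f : ℝ → ℝ) (σ : ℝ) : 0 ≤ quadRisk μ f σ :=
  integral_nonneg fun _ => integral_nonneg fun _ => sq_nonneg _

theorem bddBelow_range_quadRisk {ι : Type*} (μ : Measure ℝ) (f : ι → ℝ → ℝ) (σ : ℝ) :
    BddBelow (range fun i => quadRisk μ (f i) σ) :=
  ⟨0, by rintro _ ⟨i, rfl⟩; exact quadRisk_nonneg _ _ _⟩

theorem sq_sub_le_of_abs_le {f : ℝ → ℝ} (hbd : ∀ x, |f x| ≤ |x|) (σ b z : ℝ) :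
    (f (b + σ * z) - b) ^ 2 ≤ 6 * b ^ 2 + 4 * σ ^ 2 * z ^ 2 := by
  nlinarith [sq_le_sq.2 (hbd (b + σ * z)), sq_nonneg (f (b + σ * z) + b), sq_nonneg (b - σ * z)]

theorem integrable_sq_bound {μ : Measure ℝ} [IsProbabilityMeasure μ]
    (hμ : Integrable (fun b => b ^ 2) μ) (σ : ℝ) :
    Integrable (fun p : ℝ × ℝ => 6 * p.1 ^ 2 + 4 * σ ^ 2 * p.2 ^ 2)
      (μ.prod _root_.stdGaussian) :=
  ((hμ.comp_fst _).const_mul 6).add ((integrable_sq_stdGaussian.comp_snd μ).const_mul (4 * σ ^ 2))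

theorem integrable_sq_residual {μ : Measure ℝ} [IsProbabilityMeasure μ]
    (hμ : Integrable (fun b => b ^ 2) μ) {f : ℝ → ℝ} (hf : Continuous f)
    (hbd : ∀ x, |f x| ≤ |x|) (σ : ℝ) :
    Integrable (fun p : ℝ × ℝ => (f (p.1 + σ * p.2) - p.1) ^ 2) (μ.prod _root_.stdGaussian) := by
  refine (integrable_sq_bound hμ σ).mono' (Continuous.aestronglyMeasurable (by fun_prop))
    (.of_forall fun p => ?_)
  rw [Real.norm_of_nonneg (sq_nonneg _)]
  exact sq_sub_le_of_abs_le hbd σ p.1 p.2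

theorem quadRisk_eq_integral_prod {μ : Measure ℝ} [IsProbabilityMeasure μ]
    (hμ : Integrable (fun b => b ^ 2) μ) {f : ℝ → ℝ} (hf : Continuous f)
    (hbd : ∀ x, |f x| ≤ |x|) (σ : ℝ) :
    quadRisk μ f σ = ∫ p : ℝ × ℝ, (f (p.1 + σ * p.2) - p.1) ^ 2 ∂μ.prod _root_.stdGaussian :=
  (integral_prod _ (integrable_sq_residual hμ hf hbd σ)).symm

theorem quadRisk_le_of_lipschitz {μ : Measure ℝ} [IsProbabilityMeasure μ]
    (hμ : Integrable (fun b => b ^ 2) μ) {f : ℝ → ℝ} (hf : Continuous f)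
    (hbd : ∀ x, |f x| ≤ |x|) (hlip : ∀ x y, |f x - f y| ≤ |x - y|) (σ τ : ℝ) :
    quadRisk μ f σ ≤ (1 + |σ - τ|) * quadRisk μ f τ +
      (|σ - τ| + |σ - τ| ^ 2) * ∫ z, z ^ 2 ∂_root_.stdGaussian := by
  have hz : ∫ z, z ^ 2 ∂_root_.stdGaussian =
      ∫ p : ℝ × ℝ, p.2 ^ 2 ∂μ.prod _root_.stdGaussian := by
    rw [integral_fun_snd (fun z : ℝ => z ^ 2)]; simp
  have i1 := (integrable_sq_residual hμ hf hbd τ).const_mul (1 + |σ - τ|)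
  have i2 := (integrable_sq_stdGaussian.comp_snd μ).const_mul (|σ - τ| + |σ - τ| ^ 2)
  rw [quadRisk_eq_integral_prod hμ hf hbd, quadRisk_eq_integral_prod hμ hf hbd, hz,
    ← integral_const_mul, ← integral_const_mul, ← integral_add i1 i2]
  refine integral_mono (integrable_sq_residual hμ hf hbd σ) (i1.add i2) fun p => ?_
  simp only
  set d := |σ - τ|
  set x := f (p.1 + τ * p.2) - p.1
  have he : |f (p.1 + σ * p.2) - f (p.1 + τ * p.2)| ≤ d * |p.2| := by
    refine (hlip _ _).trans (le_of_eq ?_)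
    rw [← abs_mul]
    ring_nf
  set e := f (p.1 + σ * p.2) - f (p.1 + τ * p.2) with hedef
  have hsum : f (p.1 + σ * p.2) - p.1 = x + e := by simp only [x, e]; ring
  rw [hsum]
  have hd : 0 ≤ d := abs_nonneg _
  have h1 : e ^ 2 ≤ d ^ 2 * p.2 ^ 2 := by
    rw [← mul_pow, sq_le_sq, abs_mul, abs_of_nonneg hd]
    exact he
  have h2 : 2 * (x * e) ≤ d * (x ^ 2 + p.2 ^ 2) := by
    have : x * e ≤ |x| * (d * |p.2|) :=
      (le_abs_self _).trans ((abs_mul x e).trans_le (mul_le_mul_of_nonneg_left he (abs_nonneg x)))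
    nlinarith [mul_nonneg hd (sq_nonneg (|x| - |p.2|)), sq_abs x, sq_abs p.2]
  nlinarith

theorem tendsto_quadRisk {μ : Measure ℝ} [IsProbabilityMeasure μ]
    (hμ : Integrable (fun b => b ^ 2) μ) {f : ℕ → ℝ → ℝ} (hf : ∀ n, Continuous (f n))
    (hbd : ∀ n x, |f n x| ≤ |x|) (hlim : ∀ x, Tendsto (fun n => f n x) atTop (nhds 0)) (σ : ℝ) :
    Tendsto (fun n => quadRisk μ (f n) σ) atTop (nhds (∫ b, b ^ 2 ∂μ)) := by
  have hb : ∫ b, b ^ 2 ∂μ = ∫ p : ℝ × ℝ, p.1 ^ 2 ∂μ.prod _root_.stdGaussian := by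
    rw [integral_fun_fst (fun z : ℝ => z ^ 2)]; simp
  simp only [fun n => quadRisk_eq_integral_prod hμ (hf n) (hbd n) σ, hb]
  refine tendsto_integral_of_dominated_convergence _
    (fun n => (integrable_sq_residual hμ (hf n) (hbd n) σ).aestronglyMeasurable)
    (integrable_sq_bound hμ σ) (fun n => .of_forall fun p => ?_) (.of_forall fun p => ?_)
  · rw [Real.norm_of_nonneg (sq_nonneg _)]
    exact sq_sub_le_of_abs_le (hbd n) σ p.1 p.2
  · simpa using ((hlim (p.1 + σ * p.2)).sub_const p.1).pow 2

/-- If `f` and `g` are the rescalings of a proximal operator to the noise levels `s ≤ t`, then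
the relative risk at level `t` is at most the one at level `s`. -/
theorem quadRisk_rescale_le {μ : Measure ℝ} [IsProbabilityMeasure μ]
    (hμ : Integrable (fun b => b ^ 2) μ) {q χ : ℝ} (hq : 1 ≤ q) (hq2 : q ≤ 2) (hχ : 0 ≤ χ)
    {k f g : ℝ → ℝ} (hk : ∀ u, IsProx q χ u (k u)) {s t : ℝ} (hs : 0 < s) (hst : s ≤ t)
    (hf : ∀ u, f (s * u) = s * k u) (hg : ∀ u, g (t * u) = t * k u) :
    quadRisk μ g t * s ^ 2 ≤ quadRisk μ f s * t ^ 2 := by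
  have ht : 0 < t := hs.trans_le hst
  have hkc := continuous_prox hq hχ hk
  have hkb := abs_prox_le hq hχ hk
  set h : ℝ → ℝ := fun u => u - k u with hh
  have hmono := monotone_sub_prox hq hχ hk
  have hodd : ∀ x, h (-x) = -h x := fun x => by
    simp only [hh, prox_neg hq hχ hk]; ring
  have hbd : ∀ x, |h x| ≤ |x| := fun x => by
    have hp := (hk x).firmly_nonexpansive hq hχ (isProx_zero hq hχ)
    rw [← sq_le_sq]
    simp only [hh]
    nlinarith [sq_nonneg (k x)]
  set J : ℝ → ℝ := fun b => ∫ z, (z - h (b + z)) ^ 2 ∂_root_.stdGaussian with hJ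
  have inner : ∀ {c : ℝ} {φ : ℝ → ℝ}, 0 < c → (∀ u, φ (c * u) = c * k u) → ∀ b,
      ∫ z, (φ (b + c * z) - b) ^ 2 ∂_root_.stdGaussian = c ^ 2 * J (b / c) := by
    intro c φ hc hφ b
    rw [hJ, ← integral_const_mul]
    congr 1 with z
    rw [show b + c * z = c * (b / c + z) by field_simp, hφ]
    simp only [hh]
    field_simp
    ring
  have hJint : ∀ {c : ℝ} {φ : ℝ → ℝ}, 0 < c → (∀ u, φ (c * u) = c * k u) →
      Integrable (fun b => J (b / c)) μ := by
    intro c φ hc hφ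
    have hφ' : ∀ u, φ u = c * k (u / c) := fun u => by
      rw [← hφ]; congr 1; field_simp
    have hφc : Continuous φ := by
      rw [funext hφ']; fun_prop
    have hφb : ∀ x, |φ x| ≤ |x| := fun x => by
      rw [hφ', abs_mul, abs_of_pos hc, ← le_div_iff₀' hc]
      refine (hkb _).trans_eq ?_
      rw [abs_div, abs_of_pos hc]
    have := (integrable_sq_residual hμ hφc hφb c).integral_prod_left
    simp only [inner hc hφ] at this
    refine (this.const_mul (c ^ 2)⁻¹).congr (.of_forall fun b => ?_)
    simp only
    field_simp
  have hle : ∫ b, J (b / t) ∂μ ≤ ∫ b, J (b / s) ∂μ := by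
    refine integral_mono (hJint ht hg) (hJint hs hf) fun b => ?_
    refine integral_residual_mono (by fun_prop) hmono hodd hbd
      (concaveOn_sub_prox hq hq2 hχ hk) ?_
    rw [abs_div, abs_div, abs_of_pos hs, abs_of_pos ht]
    exact div_le_div_of_nonneg_left (abs_nonneg b) hs hst
  simp only [quadRisk, inner hs hf, inner ht hg, integral_const_mul]
  have := mul_le_mul_of_nonneg_left hle (by positivity : 0 ≤ s ^ 2 * t ^ 2)
  linarith

/-- For every `q ∈ [1,2]`, `δ > 0`, `σ_w > 0`, and any random variable `B` (with law `μB`)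
with `E[B²] < ∞` independent of `Z ~ N(0,1)`, the equation
`σ² = σ_w² + (1/δ)·min_{χ ≥ 0} E[(η_q(B+σZ;χ) − B)²]` has a unique solution `σ ∈ (0,∞)`. -/
theorem unique_sigma_solution
    (q δ σw : ℝ) (hq1 : 1 ≤ q) (hq2 : q ≤ 2) (hδ : 0 < δ) (hσw : 0 < σw)
    (μB : Measure ℝ) [IsProbabilityMeasure μB]
    (hB : Integrable (fun b => b^2) μB)
    (η : ℝ → ℝ → ℝ)
    (hη : ∀ u χ, 0 ≤ χ → IsProx q χ u (η u χ)) :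
    ∃! σ : ℝ, 0 < σ ∧
      σ ^ 2 = σw ^ 2 + (1/δ) *
        ⨅ χ : NNReal, ∫ b, (∫ z, (η (b + σ * z) (χ:ℝ) - b)^2 ∂stdGaussian) ∂μB := by
  set R : ℝ → ℝ := fun σ => ⨅ χ : NNReal, quadRisk μB (fun u => η u χ) σ
  change ∃! σ : ℝ, 0 < σ ∧ σ ^ 2 = σw ^ 2 + (1 / δ) * R σ
  have hprox : ∀ χ : NNReal, ∀ u, IsProx q χ u (η u χ) := fun χ u => hη u χ χ.coe_nonneg
  have hc : ∀ χ : NNReal, Continuous fun u => η u χ := fun χ =>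
    continuous_prox hq1 χ.coe_nonneg (hprox χ)
  have hbd : ∀ (χ : NNReal) x, |η x χ| ≤ |x| := fun χ => abs_prox_le hq1 χ.coe_nonneg (hprox χ)
  have hRle : ∀ σ (χ : NNReal), R σ ≤ quadRisk μB (fun u => η u χ) σ := fun σ χ =>
    ciInf_le (bddBelow_range_quadRisk μB (fun (χ : NNReal) u => η u χ) σ) χ
  have hR0 : ∀ σ, 0 ≤ R σ := fun σ => le_ciInf fun χ => quadRisk_nonneg _ _ _
  set M := ∫ b, b ^ 2 ∂μB
  set V := ∫ z, z ^ 2 ∂_root_.stdGaussian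
  have hRM : ∀ σ, R σ ≤ M := by
    intro σ
    refine ge_of_tendsto' (tendsto_quadRisk hB (f := fun n u => η u ((n : NNReal) : ℝ))
      (fun n => hc n) (fun n => hbd n) (fun x => ?_) σ) fun n => hRle σ n
    exact tendsto_prox_atTop hq1 (u := x) fun n => by simpa using hprox n x
  have hRlip : ∀ σ τ, R σ ≤ R τ + (|σ - τ| * M + (|σ - τ| + |σ - τ| ^ 2) * V) := by
    intro σ τ
    have h1 : (R σ - (|σ - τ| + |σ - τ| ^ 2) * V) / (1 + |σ - τ|) ≤ R τ := by
      refine le_ciInf fun χ => ?_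
      rw [div_le_iff₀ (by positivity)]
      have := quadRisk_le_of_lipschitz hB (hc χ) (hbd χ)
        (abs_prox_sub_le hq1 χ.coe_nonneg (hprox χ)) σ τ
      linarith [hRle σ χ]
    rw [div_le_iff₀ (by positivity)] at h1
    nlinarith [mul_le_mul_of_nonneg_left (hRM τ) (abs_nonneg (σ - τ))]
  have hRcont : Continuous R := by
    rw [continuous_iff_continuousAt]
    intro τ
    have hω : Tendsto (fun σ => |σ - τ| * M + (|σ - τ| + |σ - τ| ^ 2) * V) (nhds τ) (nhds 0) := by
      have : Continuous fun σ => |σ - τ| * M + (|σ - τ| + |σ - τ| ^ 2) * V := by fun_prop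
      simpa using this.tendsto τ
    rw [ContinuousAt, tendsto_iff_dist_tendsto_zero]
    refine squeeze_zero (fun _ => dist_nonneg) (fun σ => ?_) hω
    rw [Real.dist_eq, abs_sub_le_iff]
    have h1 := hRlip σ τ
    have h2 := hRlip τ σ
    rw [abs_sub_comm τ σ] at h2
    constructor <;> linarith
  have hRscale : ∀ s t, 0 < s → s ≤ t → R t * s ^ 2 ≤ R s * t ^ 2 := by
    intro s t hs hst
    have ht := hs.trans_le hst
    rw [← div_le_iff₀ (by positivity)]
    refine le_ciInf fun χ => ?_
    rw [div_le_iff₀ (by positivity)]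
    obtain ⟨χ₁, hχ₁⟩ : ∃ χ₁ : NNReal, (χ₁ : ℝ) = (s ^ (2 - q))⁻¹ * χ := ⟨⟨_, by positivity⟩, rfl⟩
    obtain ⟨χ₂, hχ₂⟩ : ∃ χ₂ : NNReal, (χ₂ : ℝ) = t ^ (2 - q) * χ₁ := ⟨⟨_, by positivity⟩, rfl⟩
    have hχ : (χ : ℝ) = s ^ (2 - q) * χ₁ := by
      rw [hχ₁, mul_inv_cancel_left₀ (Real.rpow_pos_of_pos hs _).ne']
    refine (mul_le_mul_of_nonneg_right (hRle t χ₂) (by positivity)).trans ?_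
    refine quadRisk_rescale_le hB hq1 hq2 χ₁.coe_nonneg (hprox χ₁) hs hst (fun u => ?_) fun u => ?_
    · refine (hprox χ (s * u)).unique hq1 χ.coe_nonneg ?_
      rw [hχ]
      exact (hprox χ₁ u).smul hs
    · refine (hprox χ₂ (t * u)).unique hq1 χ₂.coe_nonneg ?_
      rw [hχ₂]
      exact (hprox χ₁ u).smul ht
  have hM0 : 0 ≤ M := integral_nonneg fun _ => sq_nonneg _
  set L := √(σw ^ 2 + M / δ)
  have hL2 : L ^ 2 = σw ^ 2 + M / δ := Real.sq_sqrt (by positivity)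
  have hLσ : σw ≤ L := Real.le_sqrt_of_sq_le (by linarith [div_nonneg hM0 hδ.le])
  obtain ⟨σ, hσ, hσ0⟩ : ∃ σ ∈ Icc σw L, σ ^ 2 - (σw ^ 2 + (1 / δ) * R σ) = 0 := by
    have hcont : Continuous fun σ => σ ^ 2 - (σw ^ 2 + (1 / δ) * R σ) := by fun_prop
    refine intermediate_value_Icc hLσ hcont.continuousOn ⟨?_, ?_⟩
    · have := mul_nonneg (one_div_nonneg.2 hδ.le) (hR0 σw)
      linarith
    · have := mul_le_mul_of_nonneg_left (hRM L) (one_div_nonneg.2 hδ.le)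
      rw [hL2, div_eq_mul_one_div M δ]
      linarith
  have no_two : ∀ s t, 0 < s → s < t → s ^ 2 = σw ^ 2 + (1 / δ) * R s →
      t ^ 2 = σw ^ 2 + (1 / δ) * R t → False := by
    intro s t hs hst es et
    have h := mul_le_mul_of_nonneg_left (hRscale s t hs hst.le) (one_div_nonneg.2 hδ.le)
    rw [← mul_assoc, ← mul_assoc, show 1 / δ * R s = s ^ 2 - σw ^ 2 by linarith,
      show 1 / δ * R t = t ^ 2 - σw ^ 2 by linarith] at h
    have h1 : s ^ 2 < t ^ 2 := by nlinarith
    have h2 : 0 < σw ^ 2 := by positivity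
    nlinarith
  refine ⟨σ, ⟨hσw.trans_le hσ.1, by linarith⟩, ?_⟩
  rintro τ ⟨hτ, eτ⟩
  rcases lt_trichotomy τ σ with h | h | h
  · exact (no_two τ σ hτ h eτ (by linarith)).elim
  · exact h
  · exact (no_two σ τ (hσw.trans_le hσ.1) h (by linarith) eτ).elim
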